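/- Let s ≥ 1 be an integer and let T be a finite tree on vertex set V. Suppose T contains no subtree T' with |T'| ≥ s and |V| − |T'| ≥ s, i.e., there is no subset S ⊆ V with S and V∖S both nonempty such that the induced subgraphs T[S] and T[V∖S] are both connected and |S| ≥ s and |V∖S| ≥ s. Then there exists a vertex r ∈ V such that every connected component of the subgraph of T induced on V∖{r} has fewer than s vertices. -/

import Mathlib

/-- The vertices on the `b`-side of the edge `rb`. -/
def bside {V : Type*} (T : SimpleGraph V) (r b : V) : Set V :=
  {x | (T.deleteEdges {s(r, b)}).Reachable b x}

theorem bside_self {V : Type*} (T : SimpleGraph V) (r b : V) : b ∈ bside T r b :=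
  SimpleGraph.Reachable.refl b

theorem bside_step {V : Type*} (T : SimpleGraph V) {r b x y : V} (hx : x ∈ bside T r b)
    (h : T.Adj x y) (hne : s(x, y) ≠ s(r, b)) : y ∈ bside T r b := by
  refine SimpleGraph.Reachable.trans hx (SimpleGraph.Adj.reachable ?_)
  rw [SimpleGraph.deleteEdges_adj]
  exact ⟨h, by simpa using hne⟩

theorem bside_not_mem {V : Type*} (T : SimpleGraph V) (hT : T.IsTree) {r b : V}
    (h : T.Adj r b) : r ∉ bside T r b := by
  have := SimpleGraph.isAcyclic_iff_forall_adj_isBridge.1 hT.IsAcyclic h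
  rw [SimpleGraph.isBridge_iff] at this
  intro hr
  exact this (SimpleGraph.Reachable.symm hr)

theorem bside_connected {V : Type*} (T : SimpleGraph V) (r b : V) :
    (T.induce (bside T r b)).Connected := by
  have h := ((T.deleteEdges {s(r, b)}).connectedComponentMk b).maximal_connected_induce_supp.prop
  have e : ((T.deleteEdges {s(r, b)}).connectedComponentMk b).supp = bside T r b := by
    ext x
    simp only [SimpleGraph.ConnectedComponent.mem_supp_iff, SimpleGraph.ConnectedComponent.eq,
      bside, Set.mem_setOf_eq]
    exact SimpleGraph.reachable_comm
  rw [e] at h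
  exact h.mono (SimpleGraph.comap_monotone _ (SimpleGraph.deleteEdges_le _))

theorem bside_compl {V : Type*} (T : SimpleGraph V) (hT : T.IsTree) {r b : V}
    (h : T.Adj r b) : (bside T r b)ᶜ = bside T b r := by
  have hcov : ∀ x y, T.Walk x y → (x ∈ bside T r b ∨ x ∈ bside T b r) →
      (y ∈ bside T r b ∨ y ∈ bside T b r) := by
    intro x y w
    induction w with
    | nil => exact id
    | @cons u v w huv p ih =>
      intro hu
      apply ih
      by_cases he : s(u, v) = s(r, b)
      · rcases Sym2.eq_iff.1 he with ⟨_, rfl⟩ | ⟨_, rfl⟩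
        · exact Or.inl (bside_self _ _ _)
        · exact Or.inr (bside_self _ _ _)
      · rcases hu with hu | hu
        · exact Or.inl (bside_step T hu huv he)
        · exact Or.inr (bside_step T hu huv (by rwa [Sym2.eq_swap (a := b)]))
  ext x
  constructor
  · intro hx
    obtain ⟨w⟩ := hT.connected.preconnected b x
    exact (hcov b x w (Or.inl (bside_self _ _ _))).resolve_left hx
  · intro hx hx'
    have hx2 : (T.deleteEdges {s(r, b)}).Reachable r x := by
      rw [Sym2.eq_swap]; exact hx
    exact bside_not_mem T hT h (SimpleGraph.Reachable.trans hx' hx2.symm)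

theorem comp_subset_bside {V : Type*} (T : SimpleGraph V) (hT : T.IsTree) (r : V)
    (c : (T.induce {x | x ≠ r}).ConnectedComponent) :
    ∃ b, T.Adj r b ∧ Subtype.val '' c.supp ⊆ bside T r b := by
  classical
  obtain ⟨x, rfl⟩ := c.exists_rep
  obtain ⟨p, hp⟩ := (hT.connected.preconnected r x.1).exists_isPath
  have hxr : x.1 ≠ r := x.2
  obtain ⟨b, hb, hxb⟩ : ∃ b, T.Adj r b ∧ x.1 ∈ bside T r b := by
    generalize x.1 = z at p hp hxr
    cases p with
    | nil => exact absurd rfl hxr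
    | @cons _ b _ hb q =>
      refine ⟨b, hb, ?_⟩
      have hr := (SimpleGraph.Walk.cons_isPath_iff _ _).1 hp |>.2
      refine ⟨q.toDeleteEdges {s(r, b)} ?_⟩
      intro e he he'
      rw [Set.mem_singleton_iff] at he'
      subst he'
      exact hr (q.fst_mem_support_of_mem_edges he)
  refine ⟨b, hb, ?_⟩
  have key : ∀ u v, (T.induce {x | x ≠ r}).Walk u v → u.1 ∈ bside T r b → v.1 ∈ bside T r b := by
    intro u v w
    induction w with
    | nil => exact id
    | @cons u v w huv p ih =>
      intro hu
      refine ih (bside_step T hu huv ?_)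
      intro he
      rcases Sym2.eq_iff.1 he with ⟨h, _⟩ | ⟨_, h⟩
      · exact u.2 h
      · exact v.2 h
  rintro _ ⟨y, hy, rfl⟩
  have hy' : (T.induce {x | x ≠ r}).Reachable y x := SimpleGraph.ConnectedComponent.exact hy
  obtain ⟨w⟩ := hy'.symm
  exact key _ _ w hxb

theorem bside_ssubset {V : Type*} (T : SimpleGraph V) (hT : T.IsTree) {r b b' : V}
    (hb' : T.Adj b b') (hne : b' ≠ r) : bside T b b' ⊂ bside T r b := by
  have hnb := bside_not_mem T hT hb'
  have key : ∀ u v, (T.deleteEdges {s(b, b')}).Walk u v → u ∈ bside T b b' →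
      u ∈ bside T r b → v ∈ bside T r b := by
    intro u v w
    induction w with
    | nil => exact fun _ h => h
    | @cons u v w huv p ih =>
      intro hu hu'
      have hv : v ∈ bside T b b' := SimpleGraph.Reachable.trans hu huv.reachable
      refine ih hv (bside_step T hu' (SimpleGraph.deleteEdges_le _ huv) ?_)
      intro he
      rcases Sym2.eq_iff.1 he with ⟨_, rfl⟩ | ⟨rfl, _⟩
      · exact hnb hv
      · exact hnb hu
  have hb'm : b' ∈ bside T r b := by
    refine bside_step T (bside_self T r b) hb' ?_
    intro he
    rcases Sym2.eq_iff.1 he with ⟨h1, h2⟩ | ⟨_, h⟩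
    · exact hb'.ne h2.symm
    · exact hne h
  refine (Set.ssubset_iff_of_subset ?_).2 ⟨b, bside_self _ _ _, hnb⟩
  rintro x ⟨w⟩
  exact key _ _ w (bside_self _ _ _) hb'm

/-- Claim 3.9: if a finite tree `T` has no subtree `T'` with `|T'| ≥ s` and
`|T| − |T'| ≥ s`, then some vertex `r` can be removed so that every connected
component of the remaining graph has fewer than `s` vertices. -/
theorem tree_balanced_root {V : Type*} [Fintype V]
    (T : SimpleGraph V) (hT : T.IsTree) (s : ℕ) (hs : 1 ≤ s)
    (hno : ¬ ∃ S : Set V, S.Nonempty ∧ Sᶜ.Nonempty ∧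
      (T.induce S).Connected ∧ (T.induce Sᶜ).Connected ∧
      s ≤ S.ncard ∧ s ≤ Sᶜ.ncard) :
    ∃ r : V, ∀ c : (T.induce {x | x ≠ r}).ConnectedComponent,
      c.supp.ncard < s := by
  by_contra! hcon
  have hbig : ∀ r, ∃ b, T.Adj r b ∧ s ≤ (bside T r b).ncard := by
    intro r
    obtain ⟨c, hc⟩ := hcon r
    obtain ⟨b, hb, hsub⟩ := comp_subset_bside T hT r c
    refine ⟨b, hb, hc.trans ?_⟩
    rw [← Set.ncard_image_of_injective c.supp Subtype.val_injective]
    exact Set.ncard_le_ncard hsub (Set.toFinite _)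
  have hall : ∀ n r b, T.Adj r b → s ≤ (bside T r b).ncard → (bside T r b).ncard = n → False := by
    intro n
    induction n using Nat.strong_induction_on with
    | _ n ih =>
      intro r b hrb hsz hn
      obtain ⟨b', hb', hsz'⟩ := hbig b
      by_cases h : b' = r
      · subst h
        refine hno ⟨bside T b' b, ⟨b, bside_self _ _ _⟩, ?_⟩
        rw [bside_compl T hT hrb]
        exact ⟨⟨b', bside_self _ _ _⟩, bside_connected _ _ _, bside_connected _ _ _, hsz, hsz'⟩
      · have := Set.ncard_lt_ncard (bside_ssubset T hT hb' h) (Set.toFinite _)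
        exact ih _ (hn ▸ this) b b' hb' hsz' rfl
  obtain ⟨r⟩ := hT.connected.nonempty
  obtain ⟨b, hb, h⟩ := hbig r
  exact hall _ r b hb h rfl
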